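/- The integral of the return time function over the section equals the volume of the associated quotient: ∫∫_Ω R(a,b) da db = 3π²/10, where the integral is with respect to two-dimensional Lebesgue measure. -/

import Mathlib

open Matrix MeasureTheory Filter Topology

noncomputable section

abbrev SL2 := Matrix.SpecialLinearGroup (Fin 2) ℝ

/-- The golden ratio φ = (1+√5)/2. -/
def phi : ℝ := (1 + Real.sqrt 5) / 2

/-- φ̄ = 1/φ. -/
def phib : ℝ := phi⁻¹

/-- S = [[0,−1],[1,0]]. -/
def Smat : SL2 := ⟨!![0, -1; 1, 0], by norm_num [Matrix.det_fin_two_of]⟩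

/-- P = [[1,φ],[0,1]]. -/
def Pmat : SL2 := ⟨!![1, phi; 0, 1], by norm_num [Matrix.det_fin_two_of]⟩

/-- The Veech group of the golden L: the subgroup generated by S and P. -/
def Γ : Subgroup SL2 := Subgroup.closure {Smat, Pmat}

/-- Linear action of a 2×2 matrix on ℝ². -/
def mact (g : Matrix (Fin 2) (Fin 2) ℝ) (v : ℝ × ℝ) : ℝ × ℝ :=
  (g 0 0 * v.1 + g 0 1 * v.2, g 1 0 * v.1 + g 1 1 * v.2)

/-- Λ = Γ·(1,0)ᵀ. -/
def Λ : Set (ℝ × ℝ) := {v | ∃ γ ∈ Γ, v = mact (γ : Matrix (Fin 2) (Fin 2) ℝ) (1, 0)}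

/-- g_{a,b} = [[a,b],[0,1/a]]. -/
def gab (a b : ℝ) : Matrix (Fin 2) (Fin 2) ℝ := !![a, b; 0, a⁻¹]

/-- h_s = [[1,0],[−s,1]]. -/
def hmat (s : ℝ) : Matrix (Fin 2) (Fin 2) ℝ := !![1, 0; -s, 1]

/-- Ω = {(a,b) : 0 < a ≤ 1, 1 − aφ < b ≤ 1}. -/
def Ω : Set (ℝ × ℝ) := {p | 0 < p.1 ∧ p.1 ≤ 1 ∧ 1 - p.1 * phi < p.2 ∧ p.2 ≤ 1}

/-- Ω₁ = {(a,b) ∈ Ω : φ̄ ≤ a ≤ 1, 1 − aφ < b ≤ φ̄ − a}. -/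
def Ω₁ : Set (ℝ × ℝ) :=
  {p | p ∈ Ω ∧ phib ≤ p.1 ∧ p.1 ≤ 1 ∧ 1 - p.1 * phi < p.2 ∧ p.2 ≤ phib - p.1}

/-- Ω_φ = {(a,b) ∈ Ω : φ̄² ≤ a ≤ 1, φ̄ − a < b ≤ φ̄ − aφ̄}. -/
def Ωphi : Set (ℝ × ℝ) :=
  {p | p ∈ Ω ∧ phib ^ 2 ≤ p.1 ∧ p.1 ≤ 1 ∧ phib - p.1 < p.2 ∧ p.2 ≤ phib - p.1 * phib}

/-- Ω_∞ = {(a,b) ∈ Ω : φ̄ − aφ̄ < b ≤ 1}. -/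
def Ωinf : Set (ℝ × ℝ) := {p | p ∈ Ω ∧ phib - p.1 * phib < p.2 ∧ p.2 ≤ 1}

-- The return time function R.
open Classical in
noncomputable def Rfun (p : ℝ × ℝ) : ℝ :=
  if p ∈ Ω₁ then 1 / (p.1 * (p.1 + p.2))
  else if p ∈ Ωphi then 1 / (p.1 * (p.1 * phib + p.2))
  else 1 / (p.1 * p.2)

/-- The probability measure m with dm = (2/φ) da db on Ω. -/
noncomputable def m : Measure (ℝ × ℝ) := ENNReal.ofReal (2 / phi) • volume.restrict Ω

-- The golden-L BCZ map T.
open Classical in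
noncomputable def Tmap (p : ℝ × ℝ) : ℝ × ℝ :=
  if p ∈ Ω₁ then
    ((p.1 + p.2) * phi,
      p.1 + p.2 * phi +
        (-(⌊(p.1 + p.2 * phi - 1) / (phi ^ 2 * (p.1 + p.2))⌋ : ℤ) : ℝ) * phi ^ 2 * (p.1 + p.2))
  else if p ∈ Ωphi then
    (p.1 + p.2 * phi,
      p.2 + (-(⌊(p.2 - 1) / (phi * (p.1 + p.2 * phi))⌋ : ℤ) : ℝ) * phi * (p.1 + p.2 * phi))
  else
    (p.2, -p.1 + (-(⌊(-p.1 - 1) / (phi * p.2)⌋ : ℤ) : ℝ) * phi * p.2)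

/-! ### The golden ratio -/

lemma phi_sq : phi ^ 2 = phi + 1 := by
  have h : Real.sqrt 5 ^ 2 = 5 := Real.sq_sqrt (by norm_num)
  unfold phi
  linarith

lemma phi_pos : 0 < phi := by
  unfold phi
  positivity

lemma phib_pos : 0 < phib := inv_pos.mpr phi_pos

lemma phi_eq_one_add_phib : phi = 1 + phib := by
  have := phi_pos.ne'
  unfold phib
  field_simp
  linarith [phi_sq]

lemma phib_sq : phib ^ 2 = 1 - phib := by
  have h : phib * phi = 1 := inv_mul_cancel₀ phi_pos.ne'
  rw [phi_eq_one_add_phib] at h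
  linarith

lemma phib_lt_one : phib < 1 := by nlinarith [phib_sq, phib_pos]

lemma half_lt_phib : 1 / 2 < phib := by nlinarith [phib_sq, phib_pos]

/-! ### The dilogarithm -/

/-- The dilogarithm `Li₂(x) = ∑ xⁿ / n²`. -/
def dilog (x : ℝ) : ℝ := ∑' n : ℕ, x ^ (n + 1) / ((n : ℝ) + 1) ^ 2

lemma hasSum_one_div_succ_sq :
    HasSum (fun n : ℕ => 1 / ((n : ℝ) + 1) ^ 2) (Real.pi ^ 2 / 6) := by
  have h := (hasSum_nat_add_iff' (f := fun n : ℕ => 1 / (n : ℝ) ^ 2) 1).mpr hasSum_zeta_two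
  simpa using h

lemma dilog_one : dilog 1 = Real.pi ^ 2 / 6 := by
  simpa [dilog] using hasSum_one_div_succ_sq.tsum_eq

lemma dilog_zero : dilog 0 = 0 := by simp [dilog]

lemma continuousOn_dilog : ContinuousOn dilog (Set.Icc (-1) 1) := by
  have hcont (n : ℕ) : ContinuousOn (fun x : ℝ => x ^ (n + 1) / ((n : ℝ) + 1) ^ 2)
      (Set.Icc (-1) 1) := by fun_prop
  refine continuousOn_tsum hcont hasSum_one_div_succ_sq.summable fun n x hx => ?_
  rw [norm_div, norm_pow, Real.norm_of_nonneg (by positivity : 0 ≤ ((n : ℝ) + 1) ^ 2)]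
  gcongr
  exact pow_le_one₀ (norm_nonneg _) (abs_le.mpr hx)

lemma hasDerivAt_dilog {x : ℝ} (hx : |x| < 1) (hx0 : x ≠ 0) :
    HasDerivAt dilog (-Real.log (1 - x) / x) x := by
  obtain ⟨r, hxr, hr⟩ := exists_between hx
  have hr0 : 0 ≤ r := (abs_nonneg x).trans hxr.le
  have key : HasDerivAt dilog (∑' n : ℕ, x ^ n / ((n : ℝ) + 1)) x := by
    refine hasDerivAt_tsum_of_isPreconnected (t := Set.Ioo (-r) r) (y₀ := x)
      (g := fun (n : ℕ) (y : ℝ) => y ^ (n + 1) / ((n : ℝ) + 1) ^ 2)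
      (g' := fun (n : ℕ) (y : ℝ) => y ^ n / ((n : ℝ) + 1))
      (summable_geometric_of_lt_one hr0 hr) isOpen_Ioo isPreconnected_Ioo ?_ ?_
      (abs_lt.mp hxr) ?_ (abs_lt.mp hxr)
    · intro n y _
      refine ((hasDerivAt_pow (n + 1) y).div_const (((n : ℝ) + 1) ^ 2)).congr_deriv ?_
      rw [Nat.add_sub_cancel]
      push_cast
      field_simp
    · intro n y hy
      rw [norm_div, norm_pow, Real.norm_of_nonneg (by positivity : 0 ≤ (n : ℝ) + 1)]
      calc ‖y‖ ^ n / ((n : ℝ) + 1) ≤ ‖y‖ ^ n :=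
            div_le_self (by positivity) (by simp)
        _ ≤ r ^ n := by
          gcongr
          exact (abs_lt.mpr hy).le
    · refine Summable.of_norm_bounded hasSum_one_div_succ_sq.summable fun n => ?_
      rw [norm_div, norm_pow, Real.norm_of_nonneg (by positivity : 0 ≤ ((n : ℝ) + 1) ^ 2)]
      gcongr
      exact pow_le_one₀ (norm_nonneg _) hx.le
  convert key using 1
  rw [div_eq_iff hx0, ← (Real.hasSum_pow_div_log_of_abs_lt_one hx).tsum_eq, ← tsum_mul_right]
  exact tsum_congr fun n => by ring

lemma eq_of_hasDerivAt_zero {f : ℝ → ℝ} {a b : ℝ} (hab : a ≤ b)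
    (hf : ContinuousOn f (Set.Icc a b)) (hf' : ∀ x ∈ Set.Ioo a b, HasDerivAt f 0 x) :
    f b = f a := by
  have h := intervalIntegral.integral_eq_sub_of_hasDerivAt_of_le (f' := fun _ => (0 : ℝ)) hab hf
    hf' (by simp)
  simp only [intervalIntegral.integral_zero] at h
  linarith

lemma continuousOn_log_mul_log_one_sub :
    ContinuousOn (fun x => Real.log x * Real.log (1 - x)) (Set.Iio 1) := by
  have h1 : ContinuousOn (dslope (fun x => Real.log (1 - x)) 0) (Set.Iio 1) := by
    rw [continuousOn_dslope (Iio_mem_nhds one_pos)]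
    refine ⟨ContinuousOn.log (by fun_prop) fun x hx => (sub_pos.mpr hx).ne', ?_⟩
    exact DifferentiableAt.log (by fun_prop) (by norm_num)
  refine (Real.continuous_mul_log.continuousOn.mul h1).congr fun x _ => ?_
  have h2 := sub_smul_dslope (fun x => Real.log (1 - x)) 0 x
  simp only [sub_zero, Real.log_one, smul_eq_mul] at h2
  simp only [← h2, Pi.mul_apply]
  ring

lemma hasDerivAt_log_one_sub {x : ℝ} (hx : x < 1) :
    HasDerivAt (fun x => Real.log (1 - x)) (-1 / (1 - x)) x :=
  ((hasDerivAt_id x).const_sub 1).log (sub_pos.mpr hx).ne'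

/-- Euler's reflection formula. -/
lemma dilog_add_dilog_one_sub {x : ℝ} (h0 : 0 ≤ x) (h1 : x < 1) :
    dilog x + dilog (1 - x) + Real.log x * Real.log (1 - x) = Real.pi ^ 2 / 6 := by
  have h := eq_of_hasDerivAt_zero
    (f := fun x => dilog x + dilog (1 - x) + Real.log x * Real.log (1 - x)) h0 ?_ ?_
  · simpa [dilog_zero, dilog_one] using h
  · refine ((continuousOn_dilog.mono ?_).add (continuousOn_dilog.comp (by fun_prop) ?_)).add
      (continuousOn_log_mul_log_one_sub.mono ?_)
    · exact fun y hy => ⟨by linarith [hy.1], by linarith [hy.2]⟩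
    · exact fun y hy => ⟨by linarith [hy.2], by linarith [hy.1]⟩
    · exact fun y hy => hy.2.trans_lt h1
  · rintro y ⟨hy0, hyx⟩
    have hy1 : y < 1 := hyx.trans h1
    have hd1 := hasDerivAt_dilog (abs_lt.mpr ⟨by linarith, hy1⟩) hy0.ne'
    have hd2 := (hasDerivAt_dilog (x := 1 - y) (abs_lt.mpr ⟨by linarith, by linarith⟩)
      (sub_pos.mpr hy1).ne').comp y ((hasDerivAt_id y).const_sub 1)
    have hd3 := (Real.hasDerivAt_log hy0.ne').mul (hasDerivAt_log_one_sub hy1)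
    refine ((hd1.add hd2).add hd3).congr_deriv ?_
    have := (sub_pos.mpr hy1).ne'
    rw [sub_sub_cancel]
    field_simp
    ring

/-- Landen's identity. -/
lemma dilog_add_dilog_div_sub_one {x : ℝ} (h0 : 0 ≤ x) (h1 : x < 1 / 2) :
    dilog x + dilog (x / (x - 1)) + Real.log (1 - x) ^ 2 / 2 = 0 := by
  have hlt {y : ℝ} (hy : y < 1 / 2) : -1 < y / (y - 1) := by
    rw [lt_div_iff_of_neg (by linarith)]
    linarith
  have hle {y : ℝ} (hy0 : 0 ≤ y) (hy : y < 1 / 2) : y / (y - 1) ≤ 0 :=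
    div_nonpos_of_nonneg_of_nonpos hy0 (by linarith)
  have h := eq_of_hasDerivAt_zero
    (f := fun x => dilog x + dilog (x / (x - 1)) + Real.log (1 - x) ^ 2 / 2) h0 ?_ ?_
  · simpa [dilog_zero] using h
  · refine ((continuousOn_dilog.mono ?_).add (continuousOn_dilog.comp ?_ ?_)).add ?_
    · exact fun y hy => ⟨by linarith [hy.1], by linarith [hy.2]⟩
    · exact ContinuousOn.div (by fun_prop) (by fun_prop) fun y hy => by linarith [hy.2]
    · intro y hy
      have hy2 : y < 1 / 2 := hy.2.trans_lt h1
      exact ⟨(hlt hy2).le, (hle hy.1 hy2).trans zero_le_one⟩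
    · refine ((ContinuousOn.log (by fun_prop) fun y hy => ?_).pow 2).div_const 2
      linarith [hy.2]
  · rintro y ⟨hy0, hyx⟩
    have hy2 : y < 1 / 2 := hyx.trans h1
    have hy1 : y < 1 := by linarith
    have hne : y - 1 ≠ 0 := by linarith
    have hne' : 1 - y ≠ 0 := by linarith
    have hd1 := hasDerivAt_dilog (abs_lt.mpr ⟨by linarith, hy1⟩) hy0.ne'
    have hd2 := (hasDerivAt_dilog (abs_lt.mpr ⟨hlt hy2, (hle hy0.le hy2).trans_lt one_pos⟩)
      (div_ne_zero hy0.ne' hne)).comp y ((hasDerivAt_id y).div ((hasDerivAt_id y).sub_const 1) hne)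
    have hd3 := ((hasDerivAt_log_one_sub hy1).pow 2).div_const 2
    refine ((hd1.add hd2).add hd3).congr_deriv ?_
    have hinv : 1 - y / (y - 1) = (1 - y)⁻¹ := by
      field_simp
      ring
    simp only [id]
    rw [hinv, Real.log_inv]
    field_simp
    ring

/-- The duplication formula. -/
lemma dilog_add_dilog_neg {x : ℝ} (h0 : 0 ≤ x) (h1 : x < 1) :
    dilog x + dilog (-x) - dilog (x ^ 2) / 2 = 0 := by
  have h := eq_of_hasDerivAt_zero
    (f := fun x => dilog x + dilog (-x) - dilog (x ^ 2) / 2) h0 ?_ ?_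
  · simpa [dilog_zero] using h
  · refine ((continuousOn_dilog.mono ?_).add (continuousOn_dilog.comp (by fun_prop) ?_)).sub
      ((continuousOn_dilog.comp (by fun_prop) ?_).div_const 2)
    · exact fun y hy => ⟨by linarith [hy.1], by linarith [hy.2]⟩
    · exact fun y hy => ⟨by linarith [hy.2], by linarith [hy.1]⟩
    · exact fun y hy => ⟨by nlinarith, by nlinarith [hy.1, hy.2]⟩
  · rintro y ⟨hy0, hyx⟩
    have hy1 : y < 1 := hyx.trans h1
    have hd1 := hasDerivAt_dilog (abs_lt.mpr ⟨by linarith, hy1⟩) hy0.ne'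
    have hd2 := (hasDerivAt_dilog (x := -y) (abs_lt.mpr ⟨by linarith, by linarith⟩)
      (neg_ne_zero.mpr hy0.ne')).comp y (hasDerivAt_neg y)
    have hd3 := (HasDerivAt.comp (h := fun y => y ^ 2) y (hasDerivAt_dilog (x := y ^ 2)
      (abs_lt.mpr ⟨by nlinarith, by nlinarith⟩) (pow_ne_zero 2 hy0.ne'))
      (hasDerivAt_pow 2 y)).div_const 2
    refine ((hd1.add hd2).sub hd3).congr_deriv ?_
    have hlog : Real.log (1 - y ^ 2) = Real.log (1 - y) + Real.log (1 + y) := by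
      rw [← Real.log_mul (by linarith) (by linarith)]
      ring_nf
    rw [hlog, sub_neg_eq_add]
    field_simp
    ring

lemma dilog_phib_sub_dilog_phib_sq : dilog phib - dilog (phib ^ 2) = Real.pi ^ 2 / 30 := by
  have hq := phib_pos
  have hq1 := phib_lt_one
  have h1 := dilog_add_dilog_one_sub hq.le hq1
  have h2 := dilog_add_dilog_div_sub_one (x := phib ^ 2) (by positivity)
    (by linarith [phib_sq, half_lt_phib])
  have h3 := dilog_add_dilog_neg hq.le hq1
  have hx : phib ^ 2 / (phib ^ 2 - 1) = -phib := by
    rw [div_eq_iff (by linarith [phib_sq])]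
    nlinarith [phib_sq]
  have hl : Real.log (phib ^ 2) = 2 * Real.log phib := by simp
  rw [← phib_sq, hl] at h1
  rw [hx, show 1 - phib ^ 2 = phib by linarith [phib_sq]] at h2
  linarith

/-! ### Integration over the section -/

lemma lintegral_Ioc_eq_ofReal_sub {F F' : ℝ → ℝ} {g : ℝ → ENNReal} {c d : ℝ} (hcd : c ≤ d)
    (hF : ContinuousOn F (Set.Icc c d)) (hF' : ∀ x ∈ Set.Ioo c d, HasDerivAt F (F' x) x)
    (hnonneg : ∀ x ∈ Set.Ioo c d, 0 ≤ F' x)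
    (hg : ∀ x ∈ Set.Ioo c d, g x = ENNReal.ofReal (F' x)) :
    ∫⁻ x in Set.Ioc c d, g x = ENNReal.ofReal (F d - F c) := by
  have hint := intervalIntegral.integrableOn_deriv_of_nonneg hF hF' hnonneg
  rw [← intervalIntegral.integral_eq_sub_of_hasDerivAt_of_le hcd hF hF'
      ((intervalIntegrable_iff_integrableOn_Ioc_of_le hcd).mpr hint),
    intervalIntegral.integral_of_le hcd, integral_Ioc_eq_integral_Ioo,
    ofReal_integral_eq_lintegral_ofReal (hint.mono_set Set.Ioo_subset_Ioc_self)
      ((ae_restrict_iff' measurableSet_Ioo).mpr (.of_forall hnonneg)),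
    ← setLIntegral_congr Ioo_ae_eq_Ioc]
  exact setLIntegral_congr_fun measurableSet_Ioo hg

lemma lintegral_Ioc_add {g : ℝ → ENNReal} {c d e : ℝ} (hcd : c ≤ d) (hde : d ≤ e) :
    ∫⁻ x in Set.Ioc c e, g x = (∫⁻ x in Set.Ioc c d, g x) + ∫⁻ x in Set.Ioc d e, g x := by
  rw [← Set.Ioc_union_Ioc_eq_Ioc hcd hde,
    lintegral_union measurableSet_Ioc (Set.Ioc_disjoint_Ioc_of_le le_rfl)]

lemma lintegral_Ioc_one_div {g : ℝ → ENNReal} {a k c d : ℝ} (ha : 0 < a) (hc : 0 < k + c)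
    (hcd : c ≤ d) (hg : ∀ b ∈ Set.Ioo c d, g b = ENNReal.ofReal (1 / (a * (k + b)))) :
    ∫⁻ b in Set.Ioc c d, g b =
      ENNReal.ofReal (Real.log (k + d) / a - Real.log (k + c) / a) := by
  refine lintegral_Ioc_eq_ofReal_sub (F := fun b => Real.log (k + b) / a) hcd ?_ ?_ ?_ hg
  · refine (ContinuousOn.log (by fun_prop) fun b hb => ?_).div_const a
    linarith [hb.1]
  · intro b hb
    have hb' : k + b ≠ 0 := by linarith [hb.1]
    refine ((((hasDerivAt_id b).const_add k).log hb').div_const a).congr_deriv ?_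
    simp only [id]
    field_simp
  · intro b hb
    have : 0 < k + b := by linarith [hb.1]
    positivity

lemma Rfun_of_mem_Ω₁ {a b : ℝ} (ha : phib ≤ a) (ha1 : a ≤ 1) (hb : 1 - a * phi < b)
    (hb' : b ≤ phib - a) : Rfun (a, b) = 1 / (a * (a + b)) := by
  have hq := phib_pos
  have hΩ : (a, b) ∈ Ω := ⟨hq.trans_le ha, ha1, hb, by simp only; linarith [phib_lt_one]⟩
  exact if_pos ⟨hΩ, ha, ha1, hb, hb'⟩

lemma Rfun_of_mem_Ωphi {a b : ℝ} (ha : phib ^ 2 ≤ a) (ha1 : a ≤ 1) (hb : 1 - a * phi < b)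
    (hb' : phib - a < b) (hb'' : b ≤ phib - a * phib) :
    Rfun (a, b) = 1 / (a * (a * phib + b)) := by
  have hq := phib_pos
  have ha0 : 0 < a := (pow_pos hq 2).trans_le ha
  have hΩ : (a, b) ∈ Ω := ⟨ha0, ha1, hb, by
    simp only
    nlinarith [phib_lt_one, mul_pos ha0 hq]⟩
  have h1 : (a, b) ∉ Ω₁ := fun h => hb'.not_ge h.2.2.2.2
  exact (if_neg h1).trans (if_pos ⟨hΩ, ha, ha1, hb', hb''⟩)

lemma Rfun_of_mem_Ωinf {a b : ℝ} (ha : 0 < a) (hb : phib - a * phib < b) :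
    Rfun (a, b) = 1 / (a * b) := by
  have h1 : (a, b) ∉ Ω₁ := fun h => by
    have := h.2.2.2.2
    simp only at this
    nlinarith [phib_lt_one]
  have h2 : (a, b) ∉ Ωphi := fun h => hb.not_ge h.2.2.2.2
  exact (if_neg h1).trans (if_neg h2)

lemma lintegral_Rfun_of_lt_phib_sq {a : ℝ} (ha : 0 < a) (ha' : a < phib ^ 2) :
    ∫⁻ b in Set.Ioc (1 - a * phi) 1, ENNReal.ofReal (Rfun (a, b)) =
      ENNReal.ofReal (-Real.log (1 - a * phi) / a) := by
  have hq := phib_pos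
  have hsq := phib_sq
  have h1 : phib - a * phib < 1 - a * phi := by
    rw [phi_eq_one_add_phib]
    linarith
  have h2 : 0 ≤ phib - a * phib := by nlinarith
  rw [lintegral_Ioc_one_div (k := 0) ha (by linarith) (by nlinarith [phi_pos])]
  · congr 1
    simp only [zero_add, Real.log_one]
    ring
  · intro b hb
    rw [Rfun_of_mem_Ωinf ha (h1.trans hb.1), zero_add]

lemma lintegral_Rfun_of_lt_phib {a : ℝ} (ha : phib ^ 2 < a) (ha' : a < phib) :
    ∫⁻ b in Set.Ioc (1 - a * phi) 1, ENNReal.ofReal (Rfun (a, b)) =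
      ENNReal.ofReal (2 * (-Real.log (1 - a) / a)) := by
  have hq := phib_pos
  have hq1 := phib_lt_one
  have hsq := phib_sq
  have ha0 : 0 < a := (pow_pos hq 2).trans ha
  have h1 : 1 - a * phi < phib - a * phib := by
    rw [phi_eq_one_add_phib]
    linarith
  have h2 : phib - a < 1 - a * phi := by
    rw [phi_eq_one_add_phib]
    nlinarith
  have h3 : 0 < phib - a * phib := by nlinarith
  have e1 : a * phib + (1 - a * phi) = 1 - a := by
    rw [phi_eq_one_add_phib]
    ring
  rw [lintegral_Ioc_add h1.le (by nlinarith),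
    lintegral_Ioc_one_div (k := a * phib) ha0 (by linarith) h1.le fun b hb => by
      rw [Rfun_of_mem_Ωphi ha.le (by linarith) hb.1 (h2.trans hb.1) hb.2.le],
    lintegral_Ioc_one_div (k := 0) ha0 (by linarith) (by nlinarith) fun b hb => by
      rw [Rfun_of_mem_Ωinf ha0 hb.1, zero_add],
    e1, add_sub_cancel, zero_add, zero_add, Real.log_one, ← ENNReal.ofReal_add]
  · rw [show phib - a * phib = phib * (1 - a) by ring, Real.log_mul hq.ne' (by linarith)]
    congr 1
    ring
  · rw [sub_nonneg]
    gcongr <;> linarith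
  · rw [sub_nonneg]
    gcongr
    exact Real.log_nonpos h3.le (by nlinarith)

lemma lintegral_Rfun_of_phib_lt {a : ℝ} (ha : phib < a) (ha' : a < 1) :
    ∫⁻ b in Set.Ioc (1 - a * phi) 1, ENNReal.ofReal (Rfun (a, b)) =
      ENNReal.ofReal (2 * (-Real.log (1 - a * phib) / a) + -Real.log (1 - a) / a) := by
  have hq := phib_pos
  have hq1 := phib_lt_one
  have hsq := phib_sq
  have ha0 : 0 < a := hq.trans ha
  have h1 : 1 - a * phi < phib - a := by
    rw [phi_eq_one_add_phib]
    nlinarith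
  have h2 : phib - a < phib - a * phib := by nlinarith
  have h3 : 0 < phib - a * phib := by nlinarith
  have h4 : phib - a * phib < 1 := by nlinarith
  have h5 : 0 < 1 - a * phib := by nlinarith
  have e1 : a + (1 - a * phi) = 1 - a * phib := by
    rw [phi_eq_one_add_phib]
    ring
  have e2 : a * phib + (phib - a) = phib * (1 - a * phib) := by
    linear_combination a * hsq
  have hnonneg₁ : 0 ≤ Real.log phib / a - Real.log (1 - a * phib) / a := by
    rw [sub_nonneg]
    gcongr
    nlinarith
  have hnonneg₂ : 0 ≤ Real.log phib / a - Real.log (phib * (1 - a * phib)) / a := by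
    rw [sub_nonneg]
    gcongr
    nlinarith
  have hnonneg₃ : 0 ≤ 0 / a - Real.log (phib - a * phib) / a := by
    rw [sub_nonneg]
    gcongr
    exact Real.log_nonpos h3.le h4.le
  rw [lintegral_Ioc_add h1.le (h2.trans h4).le, lintegral_Ioc_add h2.le h4.le,
    lintegral_Ioc_one_div (k := a) ha0 (by linarith) h1.le fun b hb => by
      rw [Rfun_of_mem_Ω₁ ha.le ha'.le hb.1 hb.2.le],
    lintegral_Ioc_one_div (k := a * phib) ha0 (by rw [e2]; positivity) h2.le fun b hb => by
      rw [Rfun_of_mem_Ωphi (by nlinarith) ha'.le (h1.trans hb.1) hb.1 hb.2.le],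
    lintegral_Ioc_one_div (k := 0) ha0 (by linarith) h4.le fun b hb => by
      rw [Rfun_of_mem_Ωinf ha0 hb.1, zero_add],
    e1, e2, add_sub_cancel, add_sub_cancel, zero_add, zero_add, Real.log_one,
    ← ENNReal.ofReal_add hnonneg₂ hnonneg₃,
    ← ENNReal.ofReal_add hnonneg₁ (add_nonneg hnonneg₂ hnonneg₃),
    show phib - a * phib = phib * (1 - a) by ring, Real.log_mul hq.ne' h5.ne',
    Real.log_mul hq.ne' (by linarith)]
  congr 1
  ring

lemma measurableSet_Ω : MeasurableSet Ω := by
  unfold Ω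
  measurability

lemma measurable_Rfun : Measurable Rfun := by
  have h₁ : MeasurableSet Ω₁ := by
    unfold Ω₁ Ω
    simp only [Set.mem_ofPred_eq]
    measurability
  have hphi : MeasurableSet Ωphi := by
    unfold Ωphi Ω
    simp only [Set.mem_ofPred_eq]
    measurability
  exact Measurable.ite h₁ (by fun_prop) (Measurable.ite hphi (by fun_prop) (by fun_prop))

lemma Rfun_nonneg {p : ℝ × ℝ} (hp : p ∈ Ω) : 0 ≤ Rfun p := by
  obtain ⟨a, b⟩ := p
  obtain ⟨ha, ha1, hb, hb1⟩ := hp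
  simp only at ha ha1 hb hb1
  have hq := phib_pos
  have hq1 := phib_lt_one
  have hsq := phib_sq
  rw [phi_eq_one_add_phib] at hb
  unfold Rfun
  have h : 0 ≤ phib - a * phib := by nlinarith
  split_ifs with h1 h2
  · have : 0 ≤ a + b := by nlinarith
    positivity
  · have : 0 ≤ a * phib + b := by nlinarith
    positivity
  · simp only
    have : 0 ≤ b := by
      by_contra! hb0
      have hba : b ≤ phib - a * phib := hb0.le.trans h
      have ha2 : phib ^ 2 ≤ a := by nlinarith
      by_cases h3 : phib - a < b
      · exact h2 ⟨⟨ha, ha1, by rwa [phi_eq_one_add_phib], hb1⟩, ha2, ha1, h3, hba⟩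
      · push Not at h3
        refine h1 ⟨⟨ha, ha1, by rwa [phi_eq_one_add_phib], hb1⟩, ?_, ha1,
          by rwa [phi_eq_one_add_phib], h3⟩
        simp only
        nlinarith
    positivity

lemma lintegral_Ω {f : ℝ × ℝ → ENNReal} (hf : Measurable f) :
    ∫⁻ p in Ω, f p =
      ∫⁻ a in Set.Ioc 0 1, ∫⁻ b in Set.Ioc (1 - a * phi) 1, f (a, b) := by
  rw [← lintegral_indicator measurableSet_Ω, Measure.volume_eq_prod,
    lintegral_prod _ (hf.indicator measurableSet_Ω).aemeasurable,
    ← lintegral_indicator measurableSet_Ioc]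
  refine lintegral_congr fun a => ?_
  by_cases ha : a ∈ Set.Ioc (0 : ℝ) 1
  · rw [Set.indicator_of_mem ha, ← lintegral_indicator measurableSet_Ioc]
    refine lintegral_congr fun b => ?_
    have hiff : (a, b) ∈ Ω ↔ b ∈ Set.Ioc (1 - a * phi) 1 :=
      ⟨fun h => h.2.2, fun h => ⟨ha.1, ha.2, h⟩⟩
    classical
    simp only [Set.indicator_apply, hiff]
  · rw [Set.indicator_of_notMem ha]
    have hnot (b : ℝ) : (a, b) ∉ Ω := fun h => ha ⟨h.1, h.2.1⟩
    simp [Set.indicator_of_notMem (hnot _)]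

lemma neg_log_one_sub_div_nonneg {x : ℝ} (h0 : 0 ≤ x) (h1 : x ≤ 1) :
    0 ≤ -Real.log (1 - x) / x :=
  div_nonneg (neg_nonneg.mpr (Real.log_nonpos (by linarith) (by linarith))) h0

lemma continuousOn_dilog_mul {k c d : ℝ} (hc : -1 ≤ c * k) (hk : 0 ≤ k) (hd : d * k ≤ 1) :
    ContinuousOn (fun a => dilog (a * k)) (Set.Icc c d) :=
  continuousOn_dilog.comp (by fun_prop) fun a ha =>
    ⟨hc.trans (mul_le_mul_of_nonneg_right ha.1 hk), (mul_le_mul_of_nonneg_right ha.2 hk).trans hd⟩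

lemma hasDerivAt_dilog_mul {k a : ℝ} (hk : 0 < k) (ha : 0 < a) (h : a * k < 1) :
    HasDerivAt (fun a => dilog (a * k)) (-Real.log (1 - a * k) / a) a := by
  have hak : 0 < a * k := mul_pos ha hk
  refine ((hasDerivAt_dilog (abs_lt.mpr ⟨by linarith, h⟩) hak.ne').comp a
    ((hasDerivAt_id a).mul_const k)).congr_deriv ?_
  field_simp

lemma lintegral_Rfun_section :
    ∫⁻ a in Set.Ioc 0 1, ∫⁻ b in Set.Ioc (1 - a * phi) 1, ENNReal.ofReal (Rfun (a, b)) =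
      ENNReal.ofReal (3 * Real.pi ^ 2 / 10) := by
  have hq := phib_pos
  have hq1 := phib_lt_one
  have hsq := phib_sq
  have hsq0 : 0 < phib ^ 2 := by positivity
  have hlt : phib ^ 2 < phib := by nlinarith
  have hφ := phi_pos
  have hsqφ : phib ^ 2 * phi = phib := by
    rw [phi_eq_one_add_phib]
    linear_combination phib * hsq
  have hdilog : ContinuousOn dilog (Set.Icc phib 1) :=
    continuousOn_dilog.mono (Set.Icc_subset_Icc_left (by linarith))
  have hderiv {a : ℝ} (ha0 : 0 < a) (ha1 : a < 1) :
      HasDerivAt dilog (-Real.log (1 - a) / a) a :=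
    hasDerivAt_dilog (abs_lt.mpr ⟨by linarith, ha1⟩) ha0.ne'
  have hscaled {k a : ℝ} (hk : 0 < k) (ha : 0 < a) (h : a * k < 1) :
      0 ≤ -Real.log (1 - a * k) / a :=
    div_nonneg (neg_nonneg.mpr (Real.log_nonpos (by linarith) (by nlinarith))) ha.le
  rw [lintegral_Ioc_add hsq0.le (hlt.trans hq1).le, lintegral_Ioc_add hlt.le hq1.le,
    lintegral_Ioc_eq_ofReal_sub (F := fun a => dilog (a * phi))
      (F' := fun a => -Real.log (1 - a * phi) / a) hsq0.le
      (continuousOn_dilog_mul (by simp) hφ.le (by linarith))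
      (fun a ha => hasDerivAt_dilog_mul hφ ha.1 (by nlinarith [ha.2]))
      (fun a ha => hscaled hφ ha.1 (by nlinarith [ha.2]))
      (fun a ha => lintegral_Rfun_of_lt_phib_sq ha.1 ha.2),
    lintegral_Ioc_eq_ofReal_sub (F := fun a => 2 * dilog a)
      (F' := fun a => 2 * (-Real.log (1 - a) / a)) hlt.le
      ((continuousOn_dilog.mono (Set.Icc_subset_Icc (by linarith) hq1.le)).const_mul 2)
      (fun a ha => (hderiv (hsq0.trans ha.1) (ha.2.trans hq1)).const_mul 2)
      (fun a ha => mul_nonneg zero_le_two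
        (neg_log_one_sub_div_nonneg (hsq0.trans ha.1).le (ha.2.trans hq1).le))
      (fun a ha => lintegral_Rfun_of_lt_phib ha.1 ha.2),
    lintegral_Ioc_eq_ofReal_sub (F := fun a => 2 * dilog (a * phib) + dilog a)
      (F' := fun a => 2 * (-Real.log (1 - a * phib) / a) + -Real.log (1 - a) / a) hq1.le
      (((continuousOn_dilog_mul (by nlinarith) hq.le (by linarith)).const_mul 2).add hdilog)
      (fun a ha => ((hasDerivAt_dilog_mul hq (hq.trans ha.1) (by nlinarith [ha.2])).const_mul
        2).add (hderiv (hq.trans ha.1) ha.2))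
      (fun a ha => add_nonneg (mul_nonneg zero_le_two
        (hscaled hq (hq.trans ha.1) (by nlinarith [ha.2])))
        (neg_log_one_sub_div_nonneg (hq.trans ha.1).le ha.2.le))
      (fun a ha => lintegral_Rfun_of_phib_lt ha.1 ha.2)]
  have hmono : MonotoneOn dilog (Set.Icc 0 1) := by
    refine monotoneOn_of_deriv_nonneg (convex_Icc 0 1)
      (continuousOn_dilog.mono (Set.Icc_subset_Icc_left (by norm_num))) ?_ ?_ <;>
      rw [interior_Icc]
    · exact fun a ha => (hderiv ha.1 ha.2).differentiableAt.differentiableWithinAt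
    · intro a ha
      rw [(hderiv ha.1 ha.2).deriv]
      exact neg_log_one_sub_div_nonneg ha.1.le ha.2.le
  have h0 : dilog 0 ≤ dilog phib := hmono (by simp) ⟨hq.le, hq1.le⟩ hq.le
  have h1 : dilog phib ≤ dilog 1 := hmono ⟨hq.le, hq1.le⟩ (by simp) hq1.le
  have hvalue := dilog_phib_sub_dilog_phib_sq
  have hpi := Real.pi_pos
  rw [dilog_zero] at h0
  simp only [hsqφ, zero_mul, dilog_zero, one_mul, ← sq]
  rw [← ENNReal.ofReal_add, ← ENNReal.ofReal_add]
  · congr 1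
    linarith [dilog_one]
  all_goals nlinarith

/-- The integral of the return time function over the section Ω with respect to Lebesgue
measure equals the volume 3π²/10 of SL(2,ℝ)/Γ. -/
theorem integral_return_time :
    (∫ p in Ω, Rfun p) = 3 * Real.pi ^ 2 / 10 := by
  rw [integral_eq_lintegral_of_nonneg_ae
      ((ae_restrict_iff' measurableSet_Ω).mpr (.of_forall fun _ => Rfun_nonneg))
      measurable_Rfun.aestronglyMeasurable,
    lintegral_Ω measurable_Rfun.ennreal_ofReal, lintegral_Rfun_section,
    ENNReal.toReal_ofReal (by positivity)]
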